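/- arXiv:0711.1068 — 2 statements merged into one kernel-verified Lean document; each statement's English description precedes it below -/
import Mathlib

section
/- Let B be a standard Brownian motion on [0,1], β_t := B_t − t B_1 the Brownian bridge, c ∈ ℝ, and β^c_t := β_t + 6 t(1−t)(c − ∫₀¹ β). Then for all t,s ∈ [0,1]: E[β^c_t] = 6c · t(1−t), and Cov(β^c_t, β^c_s) = min(t,s) − ts − 3 t(1−t) s(1−s). Consequently the law of β^c on L²(0,1) is the Gaussian measure with mean c·a, a(θ) := 6θ(1−θ), and covariance operator Q_∞ = Q_D − 12 · (Q_D 1) ⊗ (Q_D 1), where Q_D has kernel min(t,s) − ts. -/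
open MeasureTheory ProbabilityTheory Set

/-- `B` is a standard Brownian motion on `[0,1]`: a centered Gaussian process with
continuous paths and covariance `E[B_s B_t] = min s t`. -/
def IsBrownianMotion {Ω : Type*} [MeasurableSpace Ω] (P : Measure Ω)
    (B : ℝ → Ω → ℝ) : Prop :=
  (∀ t, Measurable (B t)) ∧
  (∀ ω, ContinuousOn (fun t => B t ω) (Icc 0 1)) ∧
  (∀ (n : ℕ) (t : Fin n → ℝ), (∀ i, t i ∈ Icc (0:ℝ) 1) → ∀ c : Fin n → ℝ,
    ∃ v : NNReal,
      Measure.map (fun ω => ∑ i, c i * B (t i) ω) P = gaussianReal 0 v) ∧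
  (∀ s ∈ Icc (0:ℝ) 1, ∀ t ∈ Icc (0:ℝ) 1, ∫ ω, B s ω * B t ω ∂P = min s t)

/-- A pointwise limit of centered Gaussian real random variables is a centered Gaussian. -/
theorem exists_map_eq_gaussianReal_of_tendsto {Ω : Type*} [MeasurableSpace Ω] (P : Measure Ω)
    [IsProbabilityMeasure P] {X : ℕ → Ω → ℝ} {Y : Ω → ℝ} {v : ℕ → NNReal}
    (hX : ∀ n, Measurable (X n)) (hlaw : ∀ n, P.map (X n) = gaussianReal 0 (v n))
    (hlim : ∀ ω, Filter.Tendsto (fun n => X n ω) Filter.atTop (nhds (Y ω))) :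
    ∃ w : NNReal, P.map Y = gaussianReal 0 w := by
  have hY : Measurable Y :=
    measurable_of_tendsto_metrizable hX (tendsto_pi_nhds.2 hlim)
  have : IsProbabilityMeasure (P.map Y) := Measure.isProbabilityMeasure_map hY.aemeasurable
  have charFun_map_real : ∀ {Z : Ω → ℝ}, Measurable Z → ∀ s : ℝ,
      charFun (P.map Z) s = ∫ ω, Complex.exp (s * Z ω * Complex.I) ∂P := by
    intro Z hZ s
    rw [charFun_apply_real, integral_map hZ.aemeasurable]
    exact (by fun_prop : Continuous fun x : ℝ =>
      Complex.exp (s * x * Complex.I)).aestronglyMeasurable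
  have norm_exp_le : ∀ s x : ℝ, ‖Complex.exp (s * x * Complex.I)‖ ≤ 1 := by
    intro s x
    rw [← Complex.ofReal_mul, Complex.norm_exp_ofReal_mul_I]
  have tendsto_charFun (s : ℝ) : Filter.Tendsto
      (fun n => Complex.exp (-(v n) * s ^ 2 / 2)) Filter.atTop (nhds (charFun (P.map Y) s)) := by
    have h (n : ℕ) : Complex.exp (-(v n) * s ^ 2 / 2)
        = ∫ ω, Complex.exp (s * X n ω * Complex.I) ∂P := by
      rw [← charFun_map_real (hX n), hlaw n, charFun_gaussianReal]
      congr 1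
      push_cast
      ring
    simp_rw [h]
    rw [charFun_map_real hY]
    refine tendsto_integral_of_dominated_convergence (fun _ => 1) (fun n => ?_)
      (integrable_const _) (fun n => ae_of_all _ fun ω => norm_exp_le _ _)
      (ae_of_all _ fun ω => ?_)
    · exact (by have := hX n; fun_prop : Measurable fun ω =>
        Complex.exp (s * X n ω * Complex.I)).aestronglyMeasurable
    · exact ((by fun_prop : Continuous fun x : ℝ =>
        Complex.exp (s * x * Complex.I)).tendsto (Y ω)).comp (hlim ω)
  have charFun_continuous : Continuous (charFun (P.map Y)) := by
    rw [funext (charFun_map_real hY)]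
    refine continuous_of_dominated (bound := fun _ => 1) (fun s => ?_)
      (fun s => ae_of_all _ fun ω => norm_exp_le _ _) (integrable_const _)
      (ae_of_all _ fun ω => by fun_prop)
    exact (by fun_prop : Measurable fun ω =>
        Complex.exp (s * Y ω * Complex.I)).aestronglyMeasurable
  obtain ⟨s, hs0, hs⟩ : ∃ s : ℝ, s ≠ 0 ∧ charFun (P.map Y) s ≠ 0 := by
    have hev : ∀ᶠ s in nhds (0 : ℝ), charFun (P.map Y) s ≠ 0 :=
      charFun_continuous.continuousAt.eventually_ne (by simp)
    obtain ⟨s, h1, h2⟩ :=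
      ((hev.filter_mono nhdsWithin_le_nhds).and self_mem_nhdsWithin : ∀ᶠ s in
        nhdsWithin (0 : ℝ) {0}ᶜ, charFun (P.map Y) s ≠ 0 ∧ s ∈ ({0}ᶜ : Set ℝ)).exists
    exact ⟨s, h2, h1⟩
  have tendsto_var : Filter.Tendsto (fun n => (v n : ℝ)) Filter.atTop
      (nhds (-2 / s ^ 2 * Real.log ‖charFun (P.map Y) s‖)) := by
    have h := (((tendsto_charFun s).norm).log (norm_ne_zero_iff.2 hs)).const_mul (-2 / s ^ 2)
    refine h.congr fun n => ?_
    have hcast : Complex.exp (-(v n) * s ^ 2 / 2)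
        = ((Real.exp (-(v n) * s ^ 2 / 2) : ℝ) : ℂ) := by
      push_cast
      rfl
    rw [hcast, Complex.norm_real, Real.norm_eq_abs, Real.abs_exp, Real.log_exp]
    field_simp
  obtain ⟨w, hw⟩ : ∃ w : NNReal, (w : ℝ) = -2 / s ^ 2 * Real.log ‖charFun (P.map Y) s‖ :=
    ⟨⟨_, ge_of_tendsto' tendsto_var fun n => (v n).2⟩, rfl⟩
  rw [← hw] at tendsto_var
  refine ⟨w, Measure.ext_of_charFun (funext fun u => ?_)⟩
  refine tendsto_nhds_unique (tendsto_charFun u) ?_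
  rw [charFun_gaussianReal]
  have hcont : Continuous fun x : ℝ => Complex.exp (-x * u ^ 2 / 2) := by fun_prop
  convert! (hcont.tendsto _).comp tendsto_var using 2
  congr 1
  simp
  ring

/-- Left Riemann sums of a continuous function on `[0,1]` converge to its integral. -/
theorem tendsto_riemannSum_of_continuousOn {f : ℝ → ℝ} (hf : ContinuousOn f (Icc 0 1)) :
    Filter.Tendsto (fun n : ℕ => ∑ i : Fin n, (1 / (n : ℝ)) * f (i / n)) Filter.atTop
      (nhds (∫ r in (0:ℝ)..1, f r)) := by
  rw [Metric.tendsto_atTop]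
  intro ε hε
  obtain ⟨δ, hδ, hfδ⟩ := Metric.uniformContinuousOn_iff.1
    (isCompact_Icc.uniformContinuousOn_of_continuous hf) (ε / 2) (half_pos hε)
  obtain ⟨N, hN⟩ := exists_nat_gt (1 / δ)
  have hNpos : (0 : ℝ) < N := (one_div_pos.2 hδ).trans hN
  refine ⟨N, fun n hn => ?_⟩
  have hnN : (N : ℝ) ≤ n := by exact_mod_cast hn
  have hn0 : (0 : ℝ) < n := hNpos.trans_le hnN
  have hnδ : 1 / (n : ℝ) < δ := by
    rw [div_lt_iff₀ hn0]
    rw [div_lt_iff₀ hδ] at hN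
    nlinarith
  have mem_unit : ∀ k : ℕ, k ≤ n → (k : ℝ) / n ∈ Icc (0 : ℝ) 1 := fun k hk =>
    ⟨by positivity, (div_le_one hn0).2 (by exact_mod_cast hk)⟩
  have step_le (k : ℕ) : (k : ℝ) / n ≤ ((k + 1 : ℕ) : ℝ) / n := by
    gcongr
    simp
  have step_sub (k : ℕ) : ((k + 1 : ℕ) : ℝ) / n - (k : ℝ) / n = 1 / n := by
    push_cast
    ring
  have step_subset (k : ℕ) (hk : k < n) :
      Icc ((k : ℝ) / n) (((k + 1 : ℕ) : ℝ) / n) ⊆ Icc 0 1 :=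
    Icc_subset_Icc (mem_unit k hk.le).1 (mem_unit (k + 1) hk).2
  have hint (k : ℕ) (hk : k < n) :
      IntervalIntegrable f volume ((k : ℝ) / n) (((k + 1 : ℕ) : ℝ) / n) :=
    (hf.mono (by rw [uIcc_of_le (step_le k)]; exact step_subset k hk)).intervalIntegrable
  have hsum := intervalIntegral.sum_integral_adjacent_intervals
    (a := fun k : ℕ => (k : ℝ) / n) hint
  simp only [Nat.cast_zero, zero_div, div_self hn0.ne'] at hsum
  have hterm (k : ℕ) (hk : k < n) :
      ‖1 / (n : ℝ) * f (k / n) - ∫ x in ((k : ℝ) / n)..(((k + 1 : ℕ) : ℝ) / n), f x‖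
        ≤ ε / 2 * (1 / n) := by
    have hconst : 1 / (n : ℝ) * f (k / n)
        = ∫ _ in ((k : ℝ) / n)..(((k + 1 : ℕ) : ℝ) / n), f (k / n) := by
      rw [intervalIntegral.integral_const, step_sub, smul_eq_mul]
    rw [hconst, ← intervalIntegral.integral_sub (by simp) (hint k hk)]
    refine (intervalIntegral.norm_integral_le_of_norm_le_const fun x hx => ?_).trans_eq
      (by rw [step_sub, abs_of_pos (by positivity)])
    rw [uIoc_of_le (step_le k)] at hx
    refine (hfδ _ (mem_unit k hk.le) x (step_subset k hk ⟨hx.1.le, hx.2⟩) ?_).le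
    rw [Real.dist_eq, abs_sub_lt_iff]
    have := step_sub k
    constructor <;> linarith [hx.1, hx.2]
  rw [Fin.sum_univ_eq_sum_range (fun i => 1 / (n : ℝ) * f (i / n)), ← hsum, dist_eq_norm,
    ← Finset.sum_sub_distrib]
  calc _ ≤ ∑ _k ∈ Finset.range n, ε / 2 * (1 / (n : ℝ)) :=
        norm_sum_le_of_le _ fun k hk => hterm k (Finset.mem_range.1 hk)
    _ = ε / 2 := by
        simp
        field_simp
    _ < ε := half_lt_self hε

namespace IsBrownianMotion

variable {Ω : Type*} [MeasurableSpace Ω] {P : Measure Ω} {B : ℝ → Ω → ℝ}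

theorem measurable_integral (hB : IsBrownianMotion P B) :
    Measurable fun ω => ∫ r in (0:ℝ)..1, B r ω := by
  have := hB.1
  exact measurable_of_tendsto_metrizable
    (f := fun n ω => ∑ i : Fin n, (1 / (n : ℝ)) * B (i / n) ω) (fun n => by fun_prop)
    (tendsto_pi_nhds.2 fun ω => tendsto_riemannSum_of_continuousOn (hB.2.1 ω))

theorem exists_map_sum_eq_gaussianReal (hB : IsBrownianMotion P B) {ι : Type*} [Fintype ι]
    {t : ι → ℝ} (ht : ∀ i, t i ∈ Icc (0:ℝ) 1) (a : ι → ℝ) :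
    ∃ v : NNReal, P.map (fun ω => ∑ i, a i * B (t i) ω) = gaussianReal 0 v := by
  have e := Fintype.equivFin ι
  obtain ⟨v, hv⟩ := hB.2.2.1 _ (t ∘ e.symm) (fun i => ht _) (a ∘ e.symm)
  refine ⟨v, hv ▸ ?_⟩
  congr 1
  ext ω
  exact (e.symm.sum_comp fun i => a i * B (t i) ω).symm

/-- Linear combinations of values of a Brownian motion and of its time integral are Gaussian. -/
theorem exists_map_sum_add_integral_eq_gaussianReal [IsProbabilityMeasure P]
    (hB : IsBrownianMotion P B) {ι : Type*} [Fintype ι]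
    {t : ι → ℝ} (ht : ∀ i, t i ∈ Icc (0:ℝ) 1) (a : ι → ℝ) (d : ℝ) :
    ∃ v : NNReal, P.map (fun ω => ∑ i, a i * B (t i) ω + d * ∫ r in (0:ℝ)..1, B r ω)
      = gaussianReal 0 v := by
  have hmeas := hB.1
  have mem_unit (n : ℕ) (i : Fin n) : (i : ℝ) / n ∈ Icc (0 : ℝ) 1 :=
    ⟨by positivity, div_le_one_of_le₀ (by exact_mod_cast i.2.le) (by positivity)⟩
  choose v hv using fun n : ℕ => hB.exists_map_sum_eq_gaussianReal
    (t := Sum.elim t fun i : Fin n => (i : ℝ) / n)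
    (by rintro (i | i); exacts [ht i, mem_unit n i])
    (Sum.elim a fun _ => d * (1 / (n : ℝ)))
  refine exists_map_eq_gaussianReal_of_tendsto P (fun n => by fun_prop) hv fun ω => ?_
  simp only [Fintype.sum_sum_type, Sum.elim_inl, Sum.elim_inr, mul_assoc]
  simpa only [Finset.mul_sum] using
    ((tendsto_riemannSum_of_continuousOn (hB.2.1 ω)).const_mul d).const_add _

theorem exists_map_eq_gaussianReal (hB : IsBrownianMotion P B) {t : ℝ}
    (ht : t ∈ Icc (0:ℝ) 1) : ∃ v : NNReal, P.map (B t) = gaussianReal 0 v := by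
  simpa using hB.exists_map_sum_eq_gaussianReal (ι := Unit) (t := fun _ => t) (fun _ => ht) 1

theorem exists_map_integral_eq_gaussianReal [IsProbabilityMeasure P]
    (hB : IsBrownianMotion P B) :
    ∃ v : NNReal, P.map (fun ω => ∫ r in (0:ℝ)..1, B r ω) = gaussianReal 0 v := by
  simpa using hB.exists_map_sum_add_integral_eq_gaussianReal (ι := Empty) (t := Empty.elim)
    (fun i => i.elim) Empty.elim 1

end IsBrownianMotion

theorem memLp_two_of_map_eq_gaussianReal {Ω : Type*} [MeasurableSpace Ω] {P : Measure Ω}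
    {X : Ω → ℝ} (hX : Measurable X) {m : ℝ} {v : NNReal} (h : P.map X = gaussianReal m v) :
    MemLp X 2 P := by
  have := memLp_id_gaussianReal' (μ := m) (v := v) 2 (by simp)
  rw [← h] at this
  exact (memLp_map_measure_iff (by fun_prop) hX.aemeasurable).1 this

theorem integral_eq_of_map_eq_gaussianReal {Ω : Type*} [MeasurableSpace Ω] {P : Measure Ω}
    {X : Ω → ℝ} (hX : Measurable X) {m : ℝ} {v : NNReal} (h : P.map X = gaussianReal m v) :
    ∫ ω, X ω ∂P = m := by
  rw [← integral_id_gaussianReal (μ := m) (v := v), ← h,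
    integral_map hX.aemeasurable (by fun_prop)]

namespace IsBrownianMotion

variable {Ω : Type*} [MeasurableSpace Ω] {P : Measure Ω} {B : ℝ → Ω → ℝ}

theorem memLp_two (hB : IsBrownianMotion P B) {t : ℝ} (ht : t ∈ Icc (0:ℝ) 1) :
    MemLp (B t) 2 P :=
  (hB.exists_map_eq_gaussianReal ht).elim fun _ h => memLp_two_of_map_eq_gaussianReal (hB.1 t) h

theorem integral_eq_zero (hB : IsBrownianMotion P B) {t : ℝ} (ht : t ∈ Icc (0:ℝ) 1) :
    ∫ ω, B t ω ∂P = 0 :=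
  (hB.exists_map_eq_gaussianReal ht).elim fun _ h => integral_eq_of_map_eq_gaussianReal (hB.1 t) h

theorem memLp_two_integral [IsProbabilityMeasure P] (hB : IsBrownianMotion P B) :
    MemLp (fun ω => ∫ r in (0:ℝ)..1, B r ω) 2 P :=
  hB.exists_map_integral_eq_gaussianReal.elim fun _ h =>
    memLp_two_of_map_eq_gaussianReal hB.measurable_integral h

theorem integral_integral_eq_zero [IsProbabilityMeasure P] (hB : IsBrownianMotion P B) :
    ∫ ω, (∫ r in (0:ℝ)..1, B r ω) ∂P = 0 :=
  hB.exists_map_integral_eq_gaussianReal.elim fun _ h =>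
    integral_eq_of_map_eq_gaussianReal hB.measurable_integral h

theorem aestronglyMeasurable_uncurry [IsProbabilityMeasure P] (hB : IsBrownianMotion P B) :
    AEStronglyMeasurable (Function.uncurry B) ((volume.restrict (Ioc (0:ℝ) 1)).prod P) := by
  have hmeas : Measurable (Function.uncurry
      fun (r : ℝ) ω => B (projIcc (0:ℝ) 1 zero_le_one r) ω) :=
    measurable_uncurry_of_continuous_of_measurable
      (fun ω => (continuousOn_iff_continuous_domRestrict.1 (hB.2.1 ω)).comp continuous_projIcc)
      fun r => hB.1 _
  refine hmeas.aestronglyMeasurable.congr ?_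
  have hmem : ∀ᵐ p ∂((volume.restrict (Ioc (0:ℝ) 1)).prod P), p.1 ∈ Ioc (0:ℝ) 1 :=
    Measure.quasiMeasurePreserving_fst.ae (ae_restrict_mem measurableSet_Ioc)
  filter_upwards [hmem] with p hp
  simp [Function.uncurry, projIcc_of_mem zero_le_one (Ioc_subset_Icc_self hp)]

theorem memLp_two_uncurry [IsProbabilityMeasure P] (hB : IsBrownianMotion P B) :
    MemLp (Function.uncurry B) 2 ((volume.restrict (Ioc (0:ℝ) 1)).prod P) := by
  have hmeas := hB.aestronglyMeasurable_uncurry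
  refine (memLp_two_iff_integrable_sq hmeas).2 ((integrable_prod_iff (hmeas.pow 2)).2 ⟨?_, ?_⟩)
  · filter_upwards [ae_restrict_mem measurableSet_Ioc] with r hr
    exact (hB.memLp_two (Ioc_subset_Icc_self hr)).integrable_sq
  · have hid : Integrable (fun r : ℝ => r) (volume.restrict (Ioc (0:ℝ) 1)) :=
      (continuous_id.integrableOn_Ioc : IntegrableOn id (Ioc (0:ℝ) 1) volume)
    refine hid.congr ?_
    filter_upwards [ae_restrict_mem measurableSet_Ioc] with r hr
    have hr' := Ioc_subset_Icc_self hr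
    simpa [Function.uncurry, sq] using (hB.2.2.2 r hr' r hr').symm

/-- Fubini for the time integral of a Brownian motion against a square-integrable variable. -/
theorem integral_integral_mul [IsProbabilityMeasure P] (hB : IsBrownianMotion P B) {Z : Ω → ℝ}
    (hZ : MemLp Z 2 P) :
    ∫ ω, (∫ r in (0:ℝ)..1, B r ω) * Z ω ∂P = ∫ r in (0:ℝ)..1, ∫ ω, B r ω * Z ω ∂P := by
  have hint : Integrable (Function.uncurry fun r ω => B r ω * Z ω)
      ((volume.restrict (Ioc (0:ℝ) 1)).prod P) :=
    hB.memLp_two_uncurry.integrable_mul (hZ.comp_snd _)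
  simp_rw [intervalIntegral.integral_of_le zero_le_one, ← integral_mul_const]
  exact (integral_integral_swap hint).symm

theorem integral_integral_mul_self_apply [IsProbabilityMeasure P] (hB : IsBrownianMotion P B)
    {t : ℝ} (ht : t ∈ Icc (0:ℝ) 1) :
    ∫ ω, (∫ r in (0:ℝ)..1, B r ω) * B t ω ∂P = t - t ^ 2 / 2 := by
  have hmin : ∫ r in (0:ℝ)..1, ∫ ω, B r ω * B t ω ∂P = ∫ r in (0:ℝ)..1, min r t :=
    intervalIntegral.integral_congr fun r hr =>
      hB.2.2.2 r (by rwa [uIcc_of_le zero_le_one] at hr) t ht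
  have hcont : Continuous fun r : ℝ => min r t := by fun_prop
  rw [hB.integral_integral_mul (hB.memLp_two ht), hmin,
    ← intervalIntegral.integral_add_adjacent_intervals (hcont.intervalIntegrable 0 t)
      (hcont.intervalIntegrable t 1)]
  have left : ∫ r in (0:ℝ)..t, min r t = ∫ r in (0:ℝ)..t, r :=
    intervalIntegral.integral_congr fun r hr => by
      rw [uIcc_of_le ht.1] at hr
      exact min_eq_left hr.2
  have right : ∫ r in t..1, min r t = ∫ _ in t..1, t :=
    intervalIntegral.integral_congr fun r hr => by
      rw [uIcc_of_le ht.2] at hr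
      exact min_eq_right hr.1
  rw [left, right, integral_id, intervalIntegral.integral_const, smul_eq_mul]
  ring

theorem integral_sq_integral [IsProbabilityMeasure P] (hB : IsBrownianMotion P B) :
    ∫ ω, (∫ r in (0:ℝ)..1, B r ω) * (∫ r in (0:ℝ)..1, B r ω) ∂P = 1 / 3 := by
  rw [hB.integral_integral_mul hB.memLp_two_integral]
  have hcongr : ∫ r in (0:ℝ)..1, ∫ ω, B r ω * (∫ u in (0:ℝ)..1, B u ω) ∂P
      = ∫ r in (0:ℝ)..1, (r - r ^ 2 / 2) :=
    intervalIntegral.integral_congr fun r hr => by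
      simp_rw [mul_comm (B r _)]
      exact hB.integral_integral_mul_self_apply (by rwa [uIcc_of_le zero_le_one] at hr)
  rw [hcongr, intervalIntegral.integral_sub (by simp)
    (Continuous.intervalIntegrable (by fun_prop) _ _)]
  simp
  norm_num

end IsBrownianMotion

/-- The conditioned Brownian bridge `β^c_t = β_t + 6t(1-t)(c - ∫₀¹ β)` has mean
`E[β^c_t] = 6c·t(1-t)` and covariance
`Cov(β^c_t, β^c_s) = min(t,s) - ts - 3t(1-t)s(1-s)`; moreover its law is Gaussian
(all finite linear combinations are Gaussian), i.e. the law of `β^c` on `L²(0,1)` is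
the Gaussian measure with mean `c·a`, `a(θ) = 6θ(1-θ)`, and covariance operator
`Q_∞ = Q_D - 12 (Q_D 1) ⊗ (Q_D 1)` where `Q_D` has kernel `min(t,s) - ts`. -/
theorem conditioned_bridge_mean_covariance
    {Ω : Type*} [MeasurableSpace Ω] (P : Measure Ω) [IsProbabilityMeasure P]
    (B : ℝ → Ω → ℝ) (hB : IsBrownianMotion P B)
    (β : ℝ → Ω → ℝ) (hβ : ∀ t ω, β t ω = B t ω - t * B 1 ω)
    (c : ℝ) (βc : ℝ → Ω → ℝ)
    (hβc : ∀ t ω, βc t ω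
      = β t ω + 6 * t * (1 - t) * (c - ∫ r in (0:ℝ)..1, β r ω)) :
    (∀ t ∈ Icc (0:ℝ) 1, ∫ ω, βc t ω ∂P = 6 * c * (t * (1 - t))) ∧
    (∀ t ∈ Icc (0:ℝ) 1, ∀ s ∈ Icc (0:ℝ) 1,
      ∫ ω, (βc t ω - 6 * c * (t * (1 - t))) * (βc s ω - 6 * c * (s * (1 - s))) ∂P
        = min t s - t * s - 3 * (t * (1 - t)) * (s * (1 - s))) ∧
    (∀ (n : ℕ) (t : Fin n → ℝ), (∀ i, t i ∈ Icc (0:ℝ) 1) → ∀ a : Fin n → ℝ,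
      ∃ (m : ℝ) (v : NNReal),
        Measure.map (fun ω => ∑ i, a i * βc (t i) ω) P = gaussianReal m v) := by
  have hmeas := hB.1
  set J : Ω → ℝ := fun ω => ∫ r in (0:ℝ)..1, B r ω
  have hJmeas : Measurable J := hB.measurable_integral
  have one_mem : (1:ℝ) ∈ Icc (0:ℝ) 1 := ⟨zero_le_one, le_rfl⟩
  have bridge_integral (ω : Ω) : ∫ r in (0:ℝ)..1, β r ω = J ω - B 1 ω / 2 := by
    simp_rw [hβ]
    rw [intervalIntegral.integral_sub, intervalIntegral.integral_mul_const, integral_id]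
    · ring
    · exact ContinuousOn.intervalIntegrable (by simpa using hB.2.1 ω)
    · exact Continuous.intervalIntegrable (by fun_prop) _ _
  have decomp (t : ℝ) (ω : Ω) : βc t ω = 6 * c * (t * (1 - t))
      + (B t ω + (3 * t * (1 - t) - t) * B 1 ω - 6 * t * (1 - t) * J ω) := by
    rw [hβc, bridge_integral, hβ]
    ring
  have hJ2 : MemLp J 2 P := hB.memLp_two_integral
  have hB1 := hB.memLp_two one_mem
  have integrable_of_memLp : ∀ {X : Ω → ℝ}, MemLp X 2 P → Integrable X P :=
    fun h => h.integrable (by norm_num)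
  refine ⟨fun t ht => ?_, fun t ht s hs => ?_, fun n t ht a => ?_⟩
  · simp_rw [decomp]
    have iB := integrable_of_memLp (hB.memLp_two ht)
    have iB1 := (integrable_of_memLp hB1).const_mul (3 * t * (1 - t) - t)
    have iJ := (integrable_of_memLp hJ2).const_mul (6 * t * (1 - t))
    have J_mean : ∫ ω, J ω ∂P = 0 := IsBrownianMotion.integral_integral_eq_zero hB
    rw [integral_add (by fun_prop) (by fun_prop), integral_sub (by fun_prop) iJ,
      integral_add iB iB1, integral_const]
    simp only [integral_const_mul]
    rw [hB.integral_eq_zero ht, hB.integral_eq_zero one_mem, J_mean]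
    simp
  · set p := 3 * t * (1 - t) - t with hp
    set q := 6 * t * (1 - t) with hq
    set p' := 3 * s * (1 - s) - s with hp'
    set q' := 6 * s * (1 - s) with hq'
    have expand (ω : Ω) : (βc t ω - 6 * c * (t * (1 - t))) * (βc s ω - 6 * c * (s * (1 - s)))
        = B t ω * B s ω + p' * (B t ω * B 1 ω) + (-q') * (J ω * B t ω)
          + p * (B s ω * B 1 ω) + p * p' * (B 1 ω * B 1 ω) + (-(p * q' + q * p')) * (J ω * B 1 ω)
          + (-q) * (J ω * B s ω) + q * q' * (J ω * J ω) := by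
      rw [decomp, decomp]
      ring
    simp_rw [expand]
    have hBt := hB.memLp_two ht
    have hBs := hB.memLp_two hs
    have mul_int : ∀ {X Y : Ω → ℝ}, MemLp X 2 P → MemLp Y 2 P →
        Integrable (fun ω => X ω * Y ω) P := fun hX hY => hX.integrable_mul hY
    have i1 := mul_int hBt hBs
    have i2 := (mul_int hBt hB1).const_mul p'
    have i3 := (mul_int hJ2 hBt).const_mul (-q')
    have i4 := (mul_int hBs hB1).const_mul p
    have i5 := (mul_int hB1 hB1).const_mul (p * p')
    have i6 := (mul_int hJ2 hB1).const_mul (-(p * q' + q * p'))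
    have i7 := (mul_int hJ2 hBs).const_mul (-q)
    have i8 := (mul_int hJ2 hJ2).const_mul (q * q')
    have J_mul : ∀ u ∈ Icc (0:ℝ) 1, ∫ ω, J ω * B u ω ∂P = u - u ^ 2 / 2 :=
      fun u hu => hB.integral_integral_mul_self_apply hu
    have J_sq : ∫ ω, J ω * J ω ∂P = 1 / 3 := hB.integral_sq_integral
    rw [integral_add (by fun_prop) i8, integral_add (by fun_prop) i7,
      integral_add (by fun_prop) i6, integral_add (by fun_prop) i5,
      integral_add (by fun_prop) i4, integral_add (by fun_prop) i3,
      integral_add i1 i2]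
    simp only [integral_const_mul]
    rw [J_mul t ht, J_mul s hs, J_mul 1 one_mem, J_sq, hB.2.2.2 t ht s hs,
      hB.2.2.2 t ht 1 one_mem, hB.2.2.2 s hs 1 one_mem, hB.2.2.2 1 one_mem 1 one_mem,
      min_eq_left ht.2, min_eq_left hs.2, min_self, hp, hq, hp', hq']
    ring
  · obtain ⟨v, hv⟩ := hB.exists_map_sum_add_integral_eq_gaussianReal (ι := Fin n ⊕ Unit)
      (t := Sum.elim t fun _ => 1) (by rintro (i | i); exacts [ht i, one_mem])
      (Sum.elim a fun _ => ∑ i, a i * (3 * t i * (1 - t i) - t i))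
      (-∑ i, a i * (6 * t i * (1 - t i)))
    have hlaw : HasLaw _ (gaussianReal 0 v) P :=
      ⟨(by fun_prop : Measurable fun ω => _ + _ * J ω).aemeasurable, hv⟩
    refine ⟨_, v, Eq.trans ?_
      (gaussianReal_const_add hlaw (∑ i, a i * (6 * c * (t i * (1 - t i))))).map_eq⟩
    congr 1
    ext ω
    simp only [decomp, Fintype.sum_sum_type, Sum.elim_inl, Sum.elim_inr, Finset.univ_unique,
      Finset.sum_singleton, neg_mul, Finset.sum_mul, ← Finset.sum_neg_distrib,
      ← Finset.sum_add_distrib]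
    exact Finset.sum_congr rfl fun i _ => by ring
end

section
/- Let q(t,s) := min(t,s) − ts (the Brownian bridge covariance), and define the finite signed measures λ(dt) := √12 ( 1_{[0,1/3]∪[2/3,1]}(t) dt + (δ_{1/3}(dt) + δ_{2/3}(dt))/6 ) and μ(dt) := √12 ( 1_{[1/3,2/3]}(t) dt − (δ_{1/3}(dt) + δ_{2/3}(dt))/6 ). For a finite signed measure ν set Qν(t) := ∫₀¹ q(t,s) ν(ds). Then: (i) Qλ(t) = √3 t(1−t) for t ∈ [0,1/3] ∪ [2/3,1] and Qλ(t) = 2√3/9 for t ∈ (1/3,2/3); (ii) Qμ(t) = 0 for t ∈ [0,1/3] ∪ [2/3,1] and Qμ(t) = √3 t(1−t) − 2√3/9 for t ∈ [1/3,2/3]; (iii) ⟨Qλ,μ⟩ = 0, ⟨Qλ,λ⟩ = 26/27 and ⟨Qμ,μ⟩ = 1/27, where ⟨h,ν⟩ := ∫₀¹ h_t ν(dt). -/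
open MeasureTheory Set

/-- The covariance kernel `min t s - t * s` integrated over an interval to the right of `t`. -/
lemma setIntegral_min_sub_mul_of_le_left {a b t : ℝ} (hab : a ≤ b) (hta : t ≤ a) :
    ∫ s in Icc a b, (min t s - t * s) = t * (b - a) - t * (b ^ 2 - a ^ 2) / 2 := by
  have h : ∫ s in Icc a b, (min t s - t * s) = ∫ s in Icc a b, (t - t * s) :=
    setIntegral_congr_fun measurableSet_Icc fun s hs => by
      simp only [min_eq_left (hta.trans hs.1)]
  rw [h, integral_Icc_eq_integral_Ioc, ← intervalIntegral.integral_of_le hab,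
    intervalIntegral.integral_sub intervalIntegrable_const
      (Continuous.intervalIntegrable (by fun_prop) _ _),
    intervalIntegral.integral_const_mul, intervalIntegral.integral_const, integral_id, smul_eq_mul]
  ring

/-- The covariance kernel `min t s - t * s` integrated over an interval to the left of `t`. -/
lemma setIntegral_min_sub_mul_of_right_le {a b t : ℝ} (hab : a ≤ b) (hbt : b ≤ t) :
    ∫ s in Icc a b, (min t s - t * s) = (1 - t) * (b ^ 2 - a ^ 2) / 2 := by
  have h : ∫ s in Icc a b, (min t s - t * s) = ∫ s in Icc a b, (1 - t) * s :=
    setIntegral_congr_fun measurableSet_Icc fun s hs => by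
      simp only [min_eq_right (hs.2.trans hbt)]
      ring
  rw [h, integral_Icc_eq_integral_Ioc, ← intervalIntegral.integral_of_le hab,
    intervalIntegral.integral_const_mul, integral_id]
  ring

/-- The covariance kernel `min t s - t * s` integrated over an interval containing `t`. -/
lemma setIntegral_min_sub_mul_of_mem {a b t : ℝ} (ht : t ∈ Icc a b) :
    ∫ s in Icc a b, (min t s - t * s) =
      (1 - t) * (t ^ 2 - a ^ 2) / 2 + (t * (b - t) - t * (b ^ 2 - t ^ 2) / 2) := by
  have hc : Continuous fun s : ℝ => min t s - t * s := by fun_prop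
  rw [← setIntegral_min_sub_mul_of_right_le ht.1 le_rfl,
    ← setIntegral_min_sub_mul_of_le_left ht.2 le_rfl]
  simp only [integral_Icc_eq_integral_Ioc]
  rw [← intervalIntegral.integral_of_le (ht.1.trans ht.2), ← intervalIntegral.integral_of_le ht.1,
    ← intervalIntegral.integral_of_le ht.2]
  exact (intervalIntegral.integral_add_adjacent_intervals (hc.intervalIntegrable _ _)
    (hc.intervalIntegrable _ _)).symm

lemma setIntegral_mul_one_sub {a b : ℝ} (hab : a ≤ b) :
    ∫ t in Icc a b, t * (1 - t) = (b ^ 2 - a ^ 2) / 2 - (b ^ 3 - a ^ 3) / 3 := by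
  have h : ∀ t : ℝ, t * (1 - t) = t - t ^ 2 := fun t => by ring
  simp only [h]
  rw [integral_Icc_eq_integral_Ioc, ← intervalIntegral.integral_of_le hab,
    intervalIntegral.integral_sub (Continuous.intervalIntegrable (by fun_prop) _ _)
      (Continuous.intervalIntegrable (by fun_prop) _ _), integral_id, integral_pow]
  norm_num

lemma setIntegral_outer_thirds {f : ℝ → ℝ} (hf : Continuous f) :
    ∫ t in Icc (0 : ℝ) (1 / 3) ∪ Icc (2 / 3) 1, f t =
      (∫ t in Icc (0 : ℝ) (1 / 3), f t) + ∫ t in Icc (2 / 3 : ℝ) 1, f t := by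
  refine setIntegral_union ?_ measurableSet_Icc hf.integrableOn_Icc hf.integrableOn_Icc
  rw [Set.disjoint_left]
  rintro t ⟨-, h₁⟩ ⟨h₂, -⟩
  linarith

/-- Computations for the signed measures
`λ(dt) = √12 (1_{[0,1/3]∪[2/3,1]}(t) dt + (δ_{1/3} + δ_{2/3})/6)` and
`μ(dt) = √12 (1_{[1/3,2/3]}(t) dt - (δ_{1/3} + δ_{2/3})/6)` paired against the
Brownian bridge covariance kernel `q(t,s) = min(t,s) - ts`.  Here `Λ = Qλ` and
`M = Qμ` are written out explicitly as the Lebesgue part plus/minus the Dirac part,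
and so are the pairings `⟨Qλ,μ⟩`, `⟨Qλ,λ⟩`, `⟨Qμ,μ⟩`. -/
theorem bridge_kernel_measure_computations
    (q : ℝ → ℝ → ℝ) (hq : ∀ t s : ℝ, q t s = min t s - t * s)
    (Λ M : ℝ → ℝ)
    (hΛ : ∀ t, Λ t = Real.sqrt 12 *
      ((∫ s in Icc (0:ℝ) (1/3) ∪ Icc (2/3) 1, q t s)
        + (q t (1/3) + q t (2/3)) / 6))
    (hM : ∀ t, M t = Real.sqrt 12 *
      ((∫ s in Icc (1/3:ℝ) (2/3), q t s)
        - (q t (1/3) + q t (2/3)) / 6)) :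
    (∀ t ∈ Icc (0:ℝ) (1/3) ∪ Icc (2/3) 1, Λ t = Real.sqrt 3 * (t * (1 - t))) ∧
    (∀ t ∈ Ioo (1/3:ℝ) (2/3), Λ t = 2 * Real.sqrt 3 / 9) ∧
    (∀ t ∈ Icc (0:ℝ) (1/3) ∪ Icc (2/3) 1, M t = 0) ∧
    (∀ t ∈ Icc (1/3:ℝ) (2/3),
      M t = Real.sqrt 3 * (t * (1 - t)) - 2 * Real.sqrt 3 / 9) ∧
    (Real.sqrt 12 * ((∫ t in Icc (1/3:ℝ) (2/3), Λ t) - (Λ (1/3) + Λ (2/3)) / 6)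
      = 0) ∧
    (Real.sqrt 12 * ((∫ t in Icc (0:ℝ) (1/3) ∪ Icc (2/3) 1, Λ t)
        + (Λ (1/3) + Λ (2/3)) / 6) = 26 / 27) ∧
    (Real.sqrt 12 * ((∫ t in Icc (1/3:ℝ) (2/3), M t) - (M (1/3) + M (2/3)) / 6)
      = 1 / 27) := by
  have h12 : Real.sqrt 12 = 2 * Real.sqrt 3 := by
    rw [show (12 : ℝ) = 2 ^ 2 * 3 by norm_num, Real.sqrt_mul (by norm_num),
      Real.sqrt_sq (by norm_num)]
  have h3 : Real.sqrt 3 * Real.sqrt 3 = 3 := Real.mul_self_sqrt (by norm_num)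
  have hqc (t : ℝ) : Continuous fun s : ℝ => min t s - t * s := by fun_prop
  simp only [hq] at hΛ hM
  have hΛ_outer : ∀ t ∈ Icc (0:ℝ) (1/3) ∪ Icc (2/3) 1, Λ t = Real.sqrt 3 * (t * (1 - t)) := by
    rintro t (ht | ht)
    · rw [hΛ, setIntegral_outer_thirds (hqc t), setIntegral_min_sub_mul_of_mem ht,
        setIntegral_min_sub_mul_of_le_left (by norm_num) (by linarith [ht.2]),
        min_eq_left ht.2, min_eq_left (by linarith [ht.2]), h12]
      ring
    · rw [hΛ, setIntegral_outer_thirds (hqc t), setIntegral_min_sub_mul_of_mem ht,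
        setIntegral_min_sub_mul_of_right_le (by norm_num) (by linarith [ht.1]),
        min_eq_right (by linarith [ht.1]), min_eq_right ht.1, h12]
      ring
  have hΛ_inner : ∀ t ∈ Ioo (1/3:ℝ) (2/3), Λ t = 2 * Real.sqrt 3 / 9 := by
    intro t ht
    rw [hΛ, setIntegral_outer_thirds (hqc t),
      setIntegral_min_sub_mul_of_right_le (by norm_num) ht.1.le,
      setIntegral_min_sub_mul_of_le_left (by norm_num) ht.2.le,
      min_eq_right ht.1.le, min_eq_left ht.2.le, h12]
    ring
  have hM_outer : ∀ t ∈ Icc (0:ℝ) (1/3) ∪ Icc (2/3) 1, M t = 0 := by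
    rintro t (ht | ht)
    · rw [hM, setIntegral_min_sub_mul_of_le_left (by norm_num) ht.2,
        min_eq_left ht.2, min_eq_left (by linarith [ht.2])]
      ring
    · rw [hM, setIntegral_min_sub_mul_of_right_le (by norm_num) ht.1,
        min_eq_right (by linarith [ht.1]), min_eq_right ht.1]
      ring
  have hM_inner : ∀ t ∈ Icc (1/3:ℝ) (2/3),
      M t = Real.sqrt 3 * (t * (1 - t)) - 2 * Real.sqrt 3 / 9 := by
    intro t ht
    rw [hM, setIntegral_min_sub_mul_of_mem ht, min_eq_right ht.1, min_eq_left ht.2, h12]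
    ring
  have hmem₁ : (1/3 : ℝ) ∈ Icc (0:ℝ) (1/3) ∪ Icc (2/3) 1 := Or.inl (by norm_num)
  have hmem₂ : (2/3 : ℝ) ∈ Icc (0:ℝ) (1/3) ∪ Icc (2/3) 1 := Or.inr (by norm_num)
  refine ⟨hΛ_outer, hΛ_inner, hM_outer, hM_inner, ?_, ?_, ?_⟩
  · rw [integral_Icc_eq_integral_Ioo, setIntegral_congr_fun measurableSet_Ioo hΛ_inner,
      setIntegral_const, hΛ_outer _ hmem₁, hΛ_outer _ hmem₂, smul_eq_mul,
      Real.volume_real_Ioo_of_le (by norm_num)]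
    ring
  · rw [setIntegral_congr_fun (measurableSet_Icc.union measurableSet_Icc) hΛ_outer,
      integral_const_mul, setIntegral_outer_thirds (by fun_prop),
      setIntegral_mul_one_sub (by norm_num), setIntegral_mul_one_sub (by norm_num),
      hΛ_outer _ hmem₁, hΛ_outer _ hmem₂, h12]
    linear_combination (26 / 81) * h3
  · rw [setIntegral_congr_fun measurableSet_Icc hM_inner,
      integral_sub (Continuous.integrableOn_Icc (by fun_prop)) (integrable_const _),
      integral_const_mul, setIntegral_mul_one_sub (by norm_num), setIntegral_const,
      hM_outer _ hmem₁, hM_outer _ hmem₂, smul_eq_mul,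
      Real.volume_real_Icc_of_le (by norm_num), h12]
    linear_combination (1 / 81) * h3
end
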